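/- Let w ∈ ℝ^m with w ≠ 0, b ∈ ℝ, p ∈ [1, ∞], q the Hölder conjugate of p, and ε ≥ 0. Then for every x ∈ ℝ^m with ⟨w, x⟩ + b ≠ 0, there exists δ ∈ ℝ^m with ‖δ‖_p ≤ ε and sign(⟨w, x + δ⟩ + b) ≠ sign(⟨w, x⟩ + b) if and only if |⟨w, x⟩ + b| ≤ ε · ‖w‖_q. Consequently, the set of correctly classifiable points vulnerable to ℓ_{p}-perturbations of size ε coincides with the margin set {x : 0 < |⟨w, x⟩ + b| ≤ ε‖w‖_q}, which depends on p only through the scaling factor ‖w‖_q. -/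

import Mathlib

open scoped ENNReal

/-- The `ℓ_p` norm of a vector in `ℝ^m`. -/
noncomputable def lpNorm {m : ℕ} (p : ℝ≥0∞) [Fact (1 ≤ p)] (v : Fin m → ℝ) : ℝ :=
  ‖(WithLp.equiv p (Fin m → ℝ)).symm v‖

theorem lpNorm_top {m : ℕ} (v : Fin m → ℝ) : lpNorm ∞ v = ‖v‖ :=
  PiLp.norm_toLp v

theorem lpNorm_one {m : ℕ} (v : Fin m → ℝ) : lpNorm 1 v = ∑ i, |v i| :=
  PiLp.norm_eq_of_L1 _

theorem lpNorm_eq_sum {m : ℕ} {p : ℝ≥0∞} [Fact (1 ≤ p)] (hp : p ≠ ∞) (v : Fin m → ℝ) :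
    lpNorm p v = (∑ i, |v i| ^ p.toReal) ^ (1 / p.toReal) :=
  PiLp.norm_eq_sum (ENNReal.toReal_pos (zero_lt_one.trans_le Fact.out).ne' hp) _

theorem lpNorm_smul {m : ℕ} (p : ℝ≥0∞) [Fact (1 ≤ p)] (c : ℝ) (v : Fin m → ℝ) :
    lpNorm p (c • v) = |c| * lpNorm p v :=
  norm_smul c (WithLp.toLp p v)

theorem lpNorm_nonneg {m : ℕ} (p : ℝ≥0∞) [Fact (1 ≤ p)] (v : Fin m → ℝ) : 0 ≤ lpNorm p v :=
  norm_nonneg _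

theorem abs_sign_le_one (r : ℝ) : |Real.sign r| ≤ 1 := by
  obtain h | h | h := Real.sign_apply_eq r <;> simp [h]

theorem mul_sign_eq_abs (r : ℝ) : r * Real.sign r = |r| := by
  obtain h | rfl | h := lt_trichotomy r 0
  · simp [Real.sign_of_neg h, abs_of_neg h]
  · simp
  · simp [Real.sign_of_pos h, abs_of_pos h]

/-- Hölder's inequality for the exponents `1` and `∞`. -/
theorem abs_sum_mul_le_lpNorm_one_mul_lpNorm_top {m : ℕ} (v w : Fin m → ℝ) :
    |∑ i, v i * w i| ≤ lpNorm 1 v * lpNorm ∞ w := by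
  rw [lpNorm_one, lpNorm_top, Finset.sum_mul]
  refine (Finset.abs_sum_le_sum_abs _ _).trans (Finset.sum_le_sum fun i _ => ?_)
  rw [abs_mul]
  exact mul_le_mul_of_nonneg_left (norm_le_pi_norm w i) (abs_nonneg _)

/-- Conjugate extended exponents are `(1, ∞)`, `(∞, 1)`, or finite conjugate exponents. -/
theorem ENNReal.HolderConjugate.eq_one_or_eq_top_or_toReal (p q : ℝ≥0∞)
    [ENNReal.HolderConjugate p q] :
    (p = 1 ∧ q = ∞) ∨ (p = ∞ ∧ q = 1) ∨
      (p ≠ ∞ ∧ q ≠ ∞ ∧ p.toReal.HolderConjugate q.toReal) := by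
  by_cases hp : p = ∞
  · exact .inr (.inl ⟨hp, (eq_top_iff_eq_one p q).1 hp⟩)
  by_cases hq : q = ∞
  · exact .inl ⟨(eq_top_iff_eq_one q p).1 hq, hq⟩
  refine .inr (.inr ⟨hp, hq, ?_⟩)
  simpa using ENNReal.HolderTriple.toReal 1 (ENNReal.toReal_pos (ne_zero p q) hp)
    (ENNReal.toReal_pos (ne_zero q p) hq)

/-- **Hölder's inequality** for `lpNorm`. -/
theorem abs_sum_mul_le_lpNorm_mul_lpNorm {m : ℕ} (p q : ℝ≥0∞) [Fact (1 ≤ p)] [Fact (1 ≤ q)]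
    [ENNReal.HolderConjugate p q] (v w : Fin m → ℝ) :
    |∑ i, v i * w i| ≤ lpNorm p v * lpNorm q w := by
  obtain ⟨rfl, rfl⟩ | ⟨rfl, rfl⟩ | ⟨hp, hq, h⟩ :=
    ENNReal.HolderConjugate.eq_one_or_eq_top_or_toReal p q
  · exact abs_sum_mul_le_lpNorm_one_mul_lpNorm_top v w
  · simpa only [mul_comm] using abs_sum_mul_le_lpNorm_one_mul_lpNorm_top w v
  · rw [lpNorm_eq_sum hp, lpNorm_eq_sum hq]
    refine abs_le'.2 ⟨Real.inner_le_Lp_mul_Lq _ v w h, ?_⟩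
    simpa using Real.inner_le_Lp_mul_Lq Finset.univ (fun i => -v i) w h

/-- The dual norm is attained: some `v` in the unit ball of `ℓ_p` pairs with `w` to `‖w‖_q`. -/
theorem exists_lpNorm_le_one_sum_mul_eq {m : ℕ} (p q : ℝ≥0∞) [Fact (1 ≤ p)] [Fact (1 ≤ q)]
    [ENNReal.HolderConjugate p q] (w : Fin m → ℝ) :
    ∃ v : Fin m → ℝ, lpNorm p v ≤ 1 ∧ ∑ i, w i * v i = lpNorm q w := by
  obtain ⟨rfl, rfl⟩ | ⟨rfl, rfl⟩ | ⟨hp, hq, h⟩ :=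
    ENNReal.HolderConjugate.eq_one_or_eq_top_or_toReal p q
  · obtain hm | hm := isEmpty_or_nonempty (Fin m)
    · exact ⟨0, by simp [lpNorm_one], by simp [lpNorm_top, Subsingleton.elim w 0]⟩
    obtain ⟨j, hj⟩ := Finite.exists_max fun i => |w i|
    refine ⟨Pi.single j (Real.sign (w j)), ?_, ?_⟩
    · rw [lpNorm_one, Finset.sum_eq_single j (fun i _ hi => by simp [hi]) (by simp)]
      simpa using abs_sign_le_one (w j)
    · rw [lpNorm_top, Finset.sum_eq_single j (fun i _ hi => by simp [hi]) (by simp),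
        Pi.single_eq_same, mul_sign_eq_abs]
      exact le_antisymm (norm_le_pi_norm w j) ((pi_norm_le_iff_of_nonneg (abs_nonneg _)).2 hj)
  · refine ⟨fun i => Real.sign (w i), ?_, ?_⟩
    · rw [lpNorm_top, pi_norm_le_iff_of_nonneg zero_le_one]
      exact fun i => abs_sign_le_one (w i)
    · simp only [lpNorm_one, mul_sign_eq_abs]
  · obtain ⟨g, hg, hgw⟩ := (NNReal.isGreatest_Lp Finset.univ (fun i => ‖w i‖₊) h.symm).1
    refine ⟨fun i => Real.sign (w i) * g i, ?_, ?_⟩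
    · rw [lpNorm_eq_sum hp]
      refine Real.rpow_le_one (by positivity) ?_ (by positivity)
      refine le_trans (Finset.sum_le_sum fun i _ => ?_)
        (show ∑ i, (g i : ℝ) ^ p.toReal ≤ 1 from mod_cast hg)
      refine Real.rpow_le_rpow (abs_nonneg _) ?_ h.nonneg
      rw [abs_mul, NNReal.abs_eq]
      exact mul_le_of_le_one_left (g i).coe_nonneg (abs_sign_le_one (w i))
    · rw [lpNorm_eq_sum hq]
      simpa [← mul_assoc, mul_sign_eq_abs] using congrArg NNReal.toReal hgw

/-- A shift of `a` by `t` with `|t| < |a|` does not change its sign. -/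
theorem Real.sign_add_eq_of_abs_lt {a t : ℝ} (h : |t| < |a|) : Real.sign (a + t) = Real.sign a := by
  obtain ha | rfl | ha := lt_trichotomy a 0
  · rw [abs_of_neg ha, abs_lt] at h
    rw [Real.sign_of_neg ha, Real.sign_of_neg (by linarith)]
  · simp [(abs_nonneg t).not_gt] at h
  · rw [abs_of_pos ha, abs_lt] at h
    rw [Real.sign_of_pos ha, Real.sign_of_pos (by linarith)]

/-- For a linear classifier `x ↦ sign(⟨w, x⟩ + b)` with `w ≠ 0`, a point `x` with
`⟨w, x⟩ + b ≠ 0` admits a sign-flipping perturbation of `ℓ_p` norm at most `ε` iff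
`|⟨w, x⟩ + b| ≤ ε · ‖w‖_q` (`q` the Hölder conjugate of `p`). Consequently, the set of
correctly classifiable points vulnerable to `ℓ_p`-perturbations of size `ε` is exactly
the margin set `{x | 0 < |⟨w, x⟩ + b| ≤ ε · ‖w‖_q}`. -/
theorem vulnerable_points_margin_set {m : ℕ}
    (w : Fin m → ℝ) (hw : w ≠ 0) (b : ℝ)
    (p q : ℝ≥0∞) [Fact (1 ≤ p)] [Fact (1 ≤ q)] (hpq : p⁻¹ + q⁻¹ = 1)
    (ε : ℝ) (hε : 0 ≤ ε) :
    (∀ x : Fin m → ℝ, ∑ i, w i * x i + b ≠ 0 →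
      ((∃ δ : Fin m → ℝ, lpNorm p δ ≤ ε ∧
          Real.sign (∑ i, w i * (x i + δ i) + b) ≠ Real.sign (∑ i, w i * x i + b))
        ↔ |∑ i, w i * x i + b| ≤ ε * lpNorm q w)) ∧
    {x : Fin m → ℝ | ∑ i, w i * x i + b ≠ 0 ∧
        ∃ δ : Fin m → ℝ, lpNorm p δ ≤ ε ∧
          Real.sign (∑ i, w i * (x i + δ i) + b) ≠ Real.sign (∑ i, w i * x i + b)}
      = {x : Fin m → ℝ | 0 < |∑ i, w i * x i + b| ∧
          |∑ i, w i * x i + b| ≤ ε * lpNorm q w} := by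
  have : ENNReal.HolderConjugate p q := ENNReal.holderConjugate_iff.2 hpq
  have key (x : Fin m → ℝ) (hx : ∑ i, w i * x i + b ≠ 0) :
      (∃ δ : Fin m → ℝ, lpNorm p δ ≤ ε ∧
          Real.sign (∑ i, w i * (x i + δ i) + b) ≠ Real.sign (∑ i, w i * x i + b))
        ↔ |∑ i, w i * x i + b| ≤ ε * lpNorm q w := by
    have shift (δ : Fin m → ℝ) :
        ∑ i, w i * (x i + δ i) + b = (∑ i, w i * x i + b) + ∑ i, w i * δ i := by
      simp only [mul_add, Finset.sum_add_distrib]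
      ring
    simp only [shift]
    set a := ∑ i, w i * x i + b
    constructor
    · rintro ⟨δ, hδ, hs⟩
      by_contra! hlt
      refine hs (Real.sign_add_eq_of_abs_lt (lt_of_le_of_lt ?_ hlt))
      simp only [mul_comm (w _)]
      exact (abs_sum_mul_le_lpNorm_mul_lpNorm p q δ w).trans
        (mul_le_mul_of_nonneg_right hδ (lpNorm_nonneg q w))
    · intro ha
      obtain ⟨v, hv, hvw⟩ := exists_lpNorm_le_one_sum_mul_eq p q w
      have hN : 0 < lpNorm q w := by
        refine (lpNorm_nonneg q w).lt_of_ne' fun h0 => ?_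
        rw [h0, mul_zero] at ha
        exact hx (abs_nonpos_iff.1 ha)
      refine ⟨(-a / lpNorm q w) • v, ?_, ?_⟩
      · rw [lpNorm_smul, abs_div, abs_neg, abs_of_pos hN]
        exact (mul_le_of_le_one_right (by positivity) hv).trans ((div_le_iff₀ hN).2 ha)
      · have hsum : ∑ i, w i * ((-a / lpNorm q w) • v) i = -a := by
          simp only [Pi.smul_apply, smul_eq_mul, mul_left_comm (w _), ← Finset.mul_sum, hvw]
          exact div_mul_cancel₀ _ hN.ne'
        rw [hsum, add_neg_cancel, Real.sign_zero]
        exact fun h => hx (Real.sign_eq_zero_iff.1 h.symm)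
  refine ⟨key, Set.ext fun x => ?_⟩
  simp only [Set.mem_ofPred_eq, abs_pos]
  exact and_congr_right (key x)
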